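/- arXiv:2405.01611 — 8 statements merged into one kernel-verified Lean document; each statement's English description precedes it below -/
import Mathlib

section
/- If A and A' are both co-supports of (P,Q), then Q(A) = Q(A'). -/
open MeasureTheory Set

/-- `A` is a co-support of `(P, Q)`: it is measurable, `(P ⊓ Q)(Aᶜ) = 0`, and for every
measurable `B ⊆ A` one has `P(B) = 0 ↔ Q(B) = 0`. -/
def IsCosupport {Ω : Type*} [MeasurableSpace Ω] (P Q : Measure Ω) (A : Set Ω) : Prop :=
  MeasurableSet A ∧ (P ⊓ Q) Aᶜ = 0 ∧
    ∀ B : Set Ω, B ⊆ A → MeasurableSet B → (P B = 0 ↔ Q B = 0)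

/-- If `P ⊓ Q` vanishes on a measurable set, then the restrictions of `P` and `Q` to that set are
mutually singular. -/
theorem mutuallySingular_restrict_of_inf_eq_zero {Ω : Type*} [MeasurableSpace Ω]
    {P Q : Measure Ω} {B : Set Ω} (hB : MeasurableSet B) (h : (P ⊓ Q) B = 0) :
    (P.restrict B).MutuallySingular (Q.restrict B) := by
  refine Measure.mutuallySingular_of_disjoint fun ν hP hQ => ?_
  have h_in : ν B = 0 := nonpos_iff_eq_zero.1 <| h ▸
    le_inf (hP.trans Measure.restrict_le_self) (hQ.trans Measure.restrict_le_self) B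
  have h_out : ν Bᶜ = 0 := nonpos_iff_eq_zero.1 <|
    (hP Bᶜ).trans_eq (by simp [Measure.restrict_apply hB.compl])
  exact (Measure.measure_univ_eq_zero.1 <| union_compl_self B ▸
    measure_union_null h_in h_out).le

/-- A co-support exceeds any other co-support only by a `Q`-null set. -/
theorem IsCosupport.measure_diff_eq_zero {Ω : Type*} [MeasurableSpace Ω] {P Q : Measure Ω}
    {A A' : Set Ω} (hA : IsCosupport P Q A) (hA' : IsCosupport P Q A') : Q (A \ A') = 0 := by
  have hB : MeasurableSet (A \ A') := hA.1.diff hA'.1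
  obtain ⟨t, ht, hPt, hQt⟩ := mutuallySingular_restrict_of_inf_eq_zero hB
    (measure_mono_null (sdiff_subset_compl A A') hA'.2.1)
  rw [Measure.restrict_apply ht] at hPt
  rw [Measure.restrict_apply ht.compl] at hQt
  have hQt' : Q (t ∩ (A \ A')) = 0 :=
    (hA.2.2 _ (inter_subset_right.trans sdiff_subset) (ht.inter hB)).1 hPt
  refine measure_mono_null (fun x hx => ?_) (measure_union_null hQt' hQt)
  by_cases hxt : x ∈ t
  · exact Or.inl ⟨hxt, hx⟩
  · exact Or.inr ⟨hxt, hx⟩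

/-- If `A` and `A'` are both co-supports of `(P, Q)`, then `Q(A) = Q(A')`. -/
theorem cosupport_q_mass_unique {Ω : Type*} [MeasurableSpace Ω] (P Q : Measure Ω)
    [IsProbabilityMeasure P] [IsProbabilityMeasure Q] (A A' : Set Ω)
    (hA : IsCosupport P Q A) (hA' : IsCosupport P Q A') : Q A = Q A' :=
  measure_congr <| (ae_le_set.2 <| hA.measure_diff_eq_zero hA').antisymm
    (ae_le_set.2 <| hA'.measure_diff_eq_zero hA)
end

section
/- There exists a co-support C of (P,Q) such that Q(C) = α_∞(P,Q); consequently, every co-support A of (P,Q) satisfies Q(A) = α_∞(P,Q). -/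
open MeasureTheory Filter Set
open scoped ENNReal NNReal

/-- `α_λ(P,Q) := (λ•P ⊓ Q)(Ω)` where `⊓` is the infimum in the lattice of measures. -/
noncomputable def alphaPR {Ω : Type*} [MeasurableSpace Ω] (P Q : Measure Ω) (l : ℝ≥0) : ℝ≥0∞ :=
  ((l : ℝ≥0∞) • P ⊓ Q) Set.univ

section Cosupport

variable {Ω : Type*} [MeasurableSpace Ω] {P Q : Measure Ω}

theorem exists_isCosupport (P Q : Measure Ω) [Q.HaveLebesgueDecomposition P] :
    ∃ C : Set Ω, IsCosupport P Q C := by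
  have hdec := Q.haveLebesgueDecomposition_add P
  have hf : Measurable (Q.rnDeriv P) := Measure.measurable_rnDeriv Q P
  obtain ⟨S, hS, hsing, hPS⟩ := Measure.mutuallySingular_singularPart Q P
  have hQ {B : Set Ω} (hBS : B ⊆ S) (hB : MeasurableSet B) :
      Q B = ∫⁻ x in B, Q.rnDeriv P x ∂P := by
    conv_lhs => rw [hdec]
    rw [Measure.add_apply, measure_mono_null hBS hsing, zero_add, withDensity_apply _ hB]
  have hN : MeasurableSet (Q.rnDeriv P ⁻¹' {0}) := hf (measurableSet_singleton 0)
  refine ⟨S \ Q.rnDeriv P ⁻¹' {0}, hS.diff hN, ?_, fun B hBC hB ↦ ?_⟩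
  · have hzero : Q (S ∩ Q.rnDeriv P ⁻¹' {0}) = 0 := by
      rw [hQ inter_subset_left (hS.inter hN)]
      exact (setLIntegral_congr_fun (hS.inter hN) fun x hx ↦ hx.2).trans lintegral_zero
    have hcompl : (S \ Q.rnDeriv P ⁻¹' {0})ᶜ ⊆ Sᶜ ∪ (S ∩ Q.rnDeriv P ⁻¹' {0}) := by
      intro x hx
      by_cases hxS : x ∈ S
      · exact Or.inr ⟨hxS, by_contra fun h ↦ hx ⟨hxS, h⟩⟩
      · exact Or.inl hxS
    refine measure_mono_null hcompl (measure_union_null ?_ ?_)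
    · exact nonpos_iff_eq_zero.1 (((inf_le_left : P ⊓ Q ≤ P) _).trans_eq hPS)
    · exact nonpos_iff_eq_zero.1 (((inf_le_right : P ⊓ Q ≤ Q) _).trans_eq hzero)
  · rw [hQ (hBC.trans sdiff_subset) hB]
    refine ⟨fun h ↦ setLIntegral_measure_zero B _ h, fun h ↦ ?_⟩
    have hae := (setLIntegral_eq_zero_iff hB hf).1 h
    refine measure_mono_null (fun x hx ↦ ?_) hae
    exact fun hx' ↦ (hBC hx).2 (hx' hx)

theorem smul_inf_apply_eq_zero {s : Set Ω} (hs : (P ⊓ Q) s = 0) (l : ℝ≥0) :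
    ((l : ℝ≥0∞) • P ⊓ Q) s = 0 := by
  obtain ⟨k, hk, hlk⟩ : ∃ k : ℝ≥0, 1 ≤ k ∧ l ≤ k :=
    ⟨max 1 l, le_max_left _ _, le_max_right _ _⟩
  set R := (l : ℝ≥0∞) • P ⊓ Q
  have hk0 : (k : ℝ≥0∞) ≠ 0 := by
    exact_mod_cast (zero_lt_one.trans_le hk).ne'
  have hle : (k : ℝ≥0∞)⁻¹ • R ≤ P ⊓ Q := by
    refine le_inf (fun t ↦ ?_) (fun t ↦ ?_)
    · calc (k : ℝ≥0∞)⁻¹ * R t ≤ (k : ℝ≥0∞)⁻¹ * (k * P t) := by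
            gcongr
            refine ((inf_le_left : R ≤ (l : ℝ≥0∞) • P) t).trans ?_
            change (l : ℝ≥0∞) * P t ≤ k * P t
            gcongr
        _ = P t := by rw [← mul_assoc, ENNReal.inv_mul_cancel hk0 ENNReal.coe_ne_top, one_mul]
    · calc (k : ℝ≥0∞)⁻¹ * R t ≤ 1 * Q t := by
            gcongr
            · exact ENNReal.inv_le_one.2 (by exact_mod_cast hk)
            · exact inf_le_right
        _ = Q t := one_mul _
  have hzero : (k : ℝ≥0∞)⁻¹ * R s = 0 := nonpos_iff_eq_zero.1 ((hle s).trans_eq hs)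
  exact (mul_eq_zero.1 hzero).resolve_left (ENNReal.inv_ne_zero.2 ENNReal.coe_ne_top)

theorem IsCosupport.alphaPR_le {A : Set Ω} (hA : IsCosupport P Q A) (l : ℝ≥0) :
    alphaPR P Q l ≤ Q A := by
  rw [alphaPR, ← measure_add_measure_compl hA.1, smul_inf_apply_eq_zero hA.2.1, add_zero]
  exact (inf_le_right : (l : ℝ≥0∞) • P ⊓ Q ≤ Q) A

theorem IsCosupport.restrict_absolutelyContinuous {A : Set Ω} (hA : IsCosupport P Q A) :
    Q.restrict A ≪ P := by
  refine Measure.AbsolutelyContinuous.mk fun B hB hPB ↦ ?_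
  rw [Measure.restrict_apply hB]
  exact (hA.2.2 _ inter_subset_right (hB.inter hA.1)).1 (measure_inter_null_of_null_left A hPB)

theorem lintegral_min_le_alphaPR {f : Ω → ℝ≥0∞} (hfQ : P.withDensity f ≤ Q) (l : ℝ≥0) :
    ∫⁻ x, min (f x) l ∂P ≤ alphaPR P Q l := by
  have hle : P.withDensity (fun x ↦ min (f x) l) ≤ (l : ℝ≥0∞) • P ⊓ Q := by
    refine le_inf ?_ ?_
    · rw [← withDensity_const]
      exact withDensity_mono (ae_of_all _ fun x ↦ min_le_right _ _)
    · exact (withDensity_mono (ae_of_all _ fun x ↦ min_le_left _ _)).trans hfQ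
  simpa [alphaPR] using hle univ

theorem tendsto_lintegral_min_natCast {f : Ω → ℝ≥0∞} (hf : Measurable f) :
    Tendsto (fun n : ℕ ↦ ∫⁻ x, min (f x) n ∂P) atTop (nhds (∫⁻ x, f x ∂P)) := by
  refine lintegral_tendsto_of_tendsto_of_monotone (fun n ↦ (hf.min measurable_const).aemeasurable)
    (ae_of_all _ fun x m n hmn ↦ min_le_min_left _ (by exact_mod_cast hmn))
    (ae_of_all _ fun x ↦ ?_)
  simpa using (tendsto_const_nhds (x := f x)).min ENNReal.tendsto_nat_nhds_top

theorem IsCosupport.measure_eq_of_tendsto_alphaPR [SigmaFinite P] [SigmaFinite Q] {A : Set Ω}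
    (hA : IsCosupport P Q A) {a : ℝ≥0∞} (ha : Tendsto (alphaPR P Q) atTop (nhds a)) :
    Q A = a := by
  refine le_antisymm ?_ (le_of_tendsto' ha hA.alphaPR_le)
  have hdens : P.withDensity ((Q.restrict A).rnDeriv P) = Q.restrict A :=
    Measure.withDensity_rnDeriv_eq _ _ hA.restrict_absolutelyContinuous
  have hmass : ∫⁻ x, (Q.restrict A).rnDeriv P x ∂P = Q A := by
    rw [← setLIntegral_univ, ← withDensity_apply _ MeasurableSet.univ, hdens,
      Measure.restrict_apply_univ]
  rw [← hmass]
  refine le_of_tendsto_of_tendsto'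
    (tendsto_lintegral_min_natCast (Measure.measurable_rnDeriv (Q.restrict A) P))
    (ha.comp tendsto_natCast_atTop_atTop) fun n ↦ ?_
  simpa using lintegral_min_le_alphaPR (hdens.le.trans Measure.restrict_le_self) (n : ℝ≥0)

end Cosupport

/-- There exists a co-support `C` of `(P,Q)` with `Q(C) = α_∞(P,Q)`, where
`α_∞(P,Q) = lim_{λ → ∞} α_λ(P,Q)`; consequently every co-support `A` of `(P,Q)`
satisfies `Q(A) = α_∞(P,Q)`. -/
theorem exists_cosupport_q_mass_eq_alphaInf {Ω : Type*} [MeasurableSpace Ω]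
    (P Q : Measure Ω) [IsProbabilityMeasure P] [IsProbabilityMeasure Q]
    (alphaInf : ℝ≥0∞) (hlim : Tendsto (alphaPR P Q) atTop (nhds alphaInf)) :
    (∃ C : Set Ω, IsCosupport P Q C ∧ Q C = alphaInf) ∧
      (∀ A : Set Ω, IsCosupport P Q A → Q A = alphaInf) := by
  have hmass (A : Set Ω) (hA : IsCosupport P Q A) : Q A = alphaInf :=
    hA.measure_eq_of_tendsto_alphaPR hlim
  obtain ⟨C, hC⟩ := exists_isCosupport P Q
  exact ⟨⟨C, hC, hmass C hC⟩, hmass⟩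
end

section
/- α_∞(P,Q) equals the infimum of Q(A) over all measurable sets A ⊆ Ω with P(Aᶜ) = 0, and this infimum is attained; in particular it is attained by the set A = {z ∈ Ω : (dP/d(P+Q))(z) > 0}, where dP/d(P+Q) is the Radon–Nikodym derivative of P with respect to P + Q. -/
open MeasureTheory Filter Set
open scoped ENNReal NNReal

section

variable {Ω : Type*} [MeasurableSpace Ω] {P Q : Measure Ω}

/-- If `A` carries `P`, then `Q A` bounds `α_l(P,Q)` for every `l`. -/
theorem alphaPR_le_of_measure_compl_eq_zero {A : Set Ω} (hA : P Aᶜ = 0) (l : ℝ≥0) :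
    alphaPR P Q l ≤ Q A := by
  have hP : ((l : ℝ≥0∞) • P ⊓ Q) Aᶜ ≤ ((l : ℝ≥0∞) • P) Aᶜ :=
    (inf_le_left : (l : ℝ≥0∞) • P ⊓ Q ≤ _) _
  have hQ : ((l : ℝ≥0∞) • P ⊓ Q) A ≤ Q A := (inf_le_right : (l : ℝ≥0∞) • P ⊓ Q ≤ _) _
  calc alphaPR P Q l ≤ ((l : ℝ≥0∞) • P ⊓ Q) A + ((l : ℝ≥0∞) • P ⊓ Q) Aᶜ := by
        rw [alphaPR, ← union_compl_self A]
        exact measure_union_le _ _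
    _ ≤ Q A + ((l : ℝ≥0∞) • P) Aᶜ := add_le_add hQ hP
    _ = Q A := by simp [hA]

/-- An absolutely continuous measure is carried by the positivity set of its density. -/
theorem measure_compl_rnDeriv_pos {μ : Measure Ω} [P.HaveLebesgueDecomposition μ]
    [SFinite μ] (h : P ≪ μ) : P {z | 0 < P.rnDeriv μ z}ᶜ = 0 := by
  have hS : MeasurableSet {z | 0 < P.rnDeriv μ z} :=
    measurableSet_lt measurable_const (Measure.measurable_rnDeriv _ _)
  rw [← Measure.setLIntegral_rnDeriv h, setLIntegral_eq_zero hS.compl]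
  intro z hz
  simpa using hz

/-- Where the density of `P` with respect to `P + Q` is at least `1 / l`, the measure `Q` is
dominated by `l • P ⊓ Q`. -/
theorem measure_one_le_mul_rnDeriv_le_alphaPR [SigmaFinite P] [SigmaFinite Q] (l : ℝ≥0) :
    Q {z | 1 ≤ (l : ℝ≥0∞) * P.rnDeriv (P + Q) z} ≤ alphaPR P Q l := by
  have hm : Measurable (P.rnDeriv (P + Q)) := Measure.measurable_rnDeriv _ _
  set T := {z | 1 ≤ (l : ℝ≥0∞) * P.rnDeriv (P + Q) z}
  have hT : MeasurableSet T := measurableSet_le measurable_const (hm.const_mul _)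
  have hPac : P ≪ P + Q := (Measure.le_add_right le_rfl).absolutelyContinuous
  have hle : Q.restrict T ≤ (l : ℝ≥0∞) • P := by
    refine Measure.le_iff.2 fun B hB => ?_
    rw [Measure.restrict_apply hB]
    calc Q (B ∩ T) ≤ (P + Q) (B ∩ T) := (Measure.le_add_left le_rfl : Q ≤ P + Q) _
      _ = ∫⁻ _ in B ∩ T, 1 ∂(P + Q) := by simp
      _ ≤ ∫⁻ z in B ∩ T, l * P.rnDeriv (P + Q) z ∂(P + Q) :=
          setLIntegral_mono (hm.const_mul _) fun z hz => hz.2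
      _ = l * P (B ∩ T) := by
          rw [lintegral_const_mul _ hm, Measure.setLIntegral_rnDeriv hPac]
      _ ≤ ((l : ℝ≥0∞) • P) B := by
          rw [Measure.smul_apply, smul_eq_mul]
          gcongr
          exact inter_subset_left
  have := (le_inf hle Measure.restrict_le_self : Q.restrict T ≤ (l : ℝ≥0∞) • P ⊓ Q) univ
  rwa [Measure.restrict_apply_univ] at this

/-- The positivity set of `dP/d(P+Q)` has `Q`-measure at most the limit of `α_l(P,Q)`. -/
theorem measure_rnDeriv_pos_le_of_tendsto_alphaPR [SigmaFinite P] [SigmaFinite Q]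
    {a : ℝ≥0∞} (hlim : Tendsto (alphaPR P Q) atTop (nhds a)) :
    Q {z | 0 < P.rnDeriv (P + Q) z} ≤ a := by
  let T : ℕ → Set Ω := fun n => {z | 1 ≤ ((n : ℝ≥0) : ℝ≥0∞) * P.rnDeriv (P + Q) z}
  have hmono : Monotone T := by
    intro m n hmn z hz
    simp only [T, mem_ofPred_eq] at hz ⊢
    exact hz.trans (by gcongr)
  have hsub : {z | 0 < P.rnDeriv (P + Q) z} ⊆ ⋃ n, T n := by
    intro z hz
    obtain ⟨n, hn⟩ := ENNReal.exists_nat_mul_gt (ne_of_gt hz) ENNReal.one_ne_top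
    exact mem_iUnion.2 ⟨n, by simpa [T] using hn.le⟩
  exact (measure_mono hsub).trans <| le_of_tendsto_of_tendsto'
    (tendsto_measure_iUnion_atTop hmono) (hlim.comp tendsto_natCast_atTop_atTop)
    fun n => measure_one_le_mul_rnDeriv_le_alphaPR (n : ℝ≥0)

end

/-- `α_∞(P,Q)` (the limit of `α_λ(P,Q)` as `λ → ∞`) equals the infimum of `Q(A)` over all
measurable sets `A` with `P(Aᶜ) = 0`, and this infimum is attained by the set
`S = {z | (dP/d(P+Q))(z) > 0}`. -/
theorem alphaInf_eq_iInf_and_attained {Ω : Type*} [MeasurableSpace Ω]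
    (P Q : Measure Ω) [IsProbabilityMeasure P] [IsProbabilityMeasure Q]
    (alphaInf : ℝ≥0∞) (hlim : Tendsto (alphaPR P Q) atTop (nhds alphaInf)) :
    (alphaInf = ⨅ (A : Set Ω) (_ : MeasurableSet A) (_ : P Aᶜ = 0), Q A) ∧
      P {z | 0 < P.rnDeriv (P + Q) z}ᶜ = 0 ∧
      Q {z | 0 < P.rnDeriv (P + Q) z} = alphaInf := by
  have hS : MeasurableSet {z | 0 < P.rnDeriv (P + Q) z} :=
    measurableSet_lt measurable_const (Measure.measurable_rnDeriv _ _)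
  have hP : P {z | 0 < P.rnDeriv (P + Q) z}ᶜ = 0 :=
    measure_compl_rnDeriv_pos (Measure.le_add_right le_rfl).absolutelyContinuous
  have hQ := measure_rnDeriv_pos_le_of_tendsto_alphaPR hlim
  have hle (A : Set Ω) (hA : P Aᶜ = 0) : alphaInf ≤ Q A :=
    le_of_tendsto' hlim (alphaPR_le_of_measure_compl_eq_zero hA)
  refine ⟨le_antisymm (le_iInf₂ fun A _ => le_iInf fun hA => hle A hA) ?_, hP,
    le_antisymm hQ (hle _ hP)⟩
  exact (iInf₂_le_of_le _ hS (iInf_le _ hP)).trans hQ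
end

section
/- α_∞(P,Q) = Q({z ∈ Ω : (dP/d(P+Q))(z) > 0}), where dP/d(P+Q) is the Radon–Nikodym derivative of P with respect to P + Q. -/
open MeasureTheory Filter Set
open scoped ENNReal NNReal

/-- The infimum of two measures has total mass at most that of the second on any set
whose complement is null for the first. -/
lemma inf_univ_le_of_compl_null {Ω : Type*} [MeasurableSpace Ω] (μ ν : Measure Ω) {s : Set Ω}
    (hμ : μ sᶜ = 0) : (μ ⊓ ν) univ ≤ ν s :=
  calc (μ ⊓ ν) univ = (μ ⊓ ν) (s ∪ sᶜ) := by rw [union_compl_self]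
    _ ≤ (μ ⊓ ν) s + (μ ⊓ ν) sᶜ := measure_union_le _ _
    _ ≤ ν s + μ sᶜ := add_le_add (Measure.le_iff'.1 inf_le_right s)
        (Measure.le_iff'.1 inf_le_left sᶜ)
    _ = ν s := by rw [hμ, add_zero]

lemma restrict_one_le_mul_rnDeriv_le {Ω : Type*} [MeasurableSpace Ω] (μ ν : Measure Ω)
    (c : ℝ≥0∞) : ν.restrict {z | 1 ≤ c * μ.rnDeriv ν z} ≤ c • μ := by
  have hm : Measurable (fun z => c * μ.rnDeriv ν z) :=
    (Measure.measurable_rnDeriv μ ν).const_mul c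
  have hs : MeasurableSet {z | 1 ≤ c * μ.rnDeriv ν z} := measurableSet_le measurable_const hm
  refine Measure.le_iff.2 fun t ht => ?_
  rw [Measure.restrict_apply ht]
  calc ν (t ∩ {z | 1 ≤ c * μ.rnDeriv ν z})
      = ∫⁻ _ in t ∩ {z | 1 ≤ c * μ.rnDeriv ν z}, 1 ∂ν := by simp
    _ ≤ ∫⁻ z in t ∩ {z | 1 ≤ c * μ.rnDeriv ν z}, c * μ.rnDeriv ν z ∂ν :=
        setLIntegral_mono hm fun z hz => hz.2
    _ = c * ∫⁻ z in t ∩ {z | 1 ≤ c * μ.rnDeriv ν z}, μ.rnDeriv ν z ∂ν :=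
        lintegral_const_mul _ (Measure.measurable_rnDeriv μ ν)
    _ ≤ c * μ (t ∩ {z | 1 ≤ c * μ.rnDeriv ν z}) := by
        gcongr
        exact Measure.setLIntegral_rnDeriv_le _
    _ ≤ c * μ t := by
        gcongr
        exact inter_subset_left
    _ = (c • μ) t := by simp

lemma iUnion_one_le_coe_mul_eq {Ω : Type*} (f : Ω → ℝ≥0∞) :
    ⋃ l : ℝ≥0, {z | 1 ≤ (l : ℝ≥0∞) * f z} = {z | 0 < f z} := by
  ext z
  simp only [mem_iUnion, mem_ofPred_eq]
  constructor
  · rintro ⟨l, hl⟩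
    refine pos_iff_ne_zero.2 fun h => ?_
    simp [h] at hl
  · intro h
    obtain ⟨n, hn⟩ := ENNReal.exists_nat_mul_gt h.ne' ENNReal.one_ne_top
    exact ⟨n, by simpa using hn.le⟩

/-- `α_∞(P,Q) = Q({z | (dP/d(P+Q))(z) > 0})`, where `α_∞(P,Q)` is the limit of
`α_λ(P,Q)` as `λ → ∞`. -/
theorem alphaInf_eq_q_mass_pos_rnDeriv {Ω : Type*} [MeasurableSpace Ω]
    (P Q : Measure Ω) [IsProbabilityMeasure P] [IsProbabilityMeasure Q] :
    Tendsto (alphaPR P Q) atTop (nhds (Q {z | 0 < P.rnDeriv (P + Q) z})) := by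
  have hac : P ≪ P + Q := Measure.AbsolutelyContinuous.rfl.add_right Q
  have hnull : P {z | 0 < P.rnDeriv (P + Q) z}ᶜ = 0 := Measure.rnDeriv_pos hac
  have hmono : Monotone fun l : ℝ≥0 => {z | 1 ≤ (l : ℝ≥0∞) * P.rnDeriv (P + Q) z} := by
    intro a b hab
    refine ofPred_subset_ofPred.2 fun z hz => hz.trans ?_
    gcongr
  have hlim := tendsto_measure_iUnion_atTop (μ := Q) hmono
  rw [iUnion_one_le_coe_mul_eq] at hlim
  refine tendsto_of_tendsto_of_tendsto_of_le_of_le hlim tendsto_const_nhds (fun l => ?_)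
    fun l => inf_univ_le_of_compl_null _ _ (by simp [hnull])
  have hle : Q.restrict {z | 1 ≤ (l : ℝ≥0∞) * P.rnDeriv (P + Q) z} ≤ (l : ℝ≥0∞) • P ⊓ Q :=
    le_inf ((Measure.restrict_mono_measure (Measure.le_add_left le_rfl) _).trans
      (restrict_one_le_mul_rnDeriv_le P (P + Q) l)) Measure.restrict_le_self
  simpa [alphaPR] using Measure.le_iff'.1 hle univ
end

section
/- For every λ ∈ (0,∞), the pair (α_λ(P,Q), α_λ(P,Q)/λ) belongs to PRD(P,Q); that is, there exists a probability measure μ on Ω with (α_λ(P,Q)/λ)•μ ≤ P and α_λ(P,Q)•μ ≤ Q. -/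
open MeasureTheory Set
open scoped ENNReal NNReal

/-- `PRD(P,Q)` is the set of pairs `(α, β)` of nonnegative reals for which there exists a
probability measure `μ` with `β•μ ≤ P` and `α•μ ≤ Q`. -/
def PRD {Ω : Type*} [MeasurableSpace Ω] (P Q : Measure Ω) : Set (ℝ × ℝ) :=
  {p | 0 ≤ p.1 ∧ 0 ≤ p.2 ∧ ∃ μ : Measure Ω, IsProbabilityMeasure μ ∧
    ENNReal.ofReal p.2 • μ ≤ P ∧ ENNReal.ofReal p.1 • μ ≤ Q}

/-- A finite measure of total mass `c` is `c • μ` for some probability measure `μ`, as soon as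
some probability measure exists to serve when `c = 0`. -/
theorem exists_isProbabilityMeasure_smul_eq {Ω : Type*} [MeasurableSpace Ω]
    (P ν : Measure Ω) [IsProbabilityMeasure P] [IsFiniteMeasure ν] :
    ∃ μ : Measure Ω, IsProbabilityMeasure μ ∧ ν univ • μ = ν := by
  rcases eq_or_ne ν 0 with rfl | hν
  · exact ⟨P, inferInstance, by simp⟩
  · have : NeZero ν := ⟨hν⟩
    refine ⟨(ν univ)⁻¹ • ν, isProbabilityMeasureSMul, ?_⟩
    rw [smul_smul, ENNReal.mul_inv_cancel (by simpa using hν) (measure_ne_top ν univ), one_smul]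

/-- For every `λ ∈ (0,∞)` the pair `(α_λ(P,Q), α_λ(P,Q)/λ)` belongs to `PRD(P,Q)`;
that is, there exists a probability measure `μ` with `(α_λ(P,Q)/λ)•μ ≤ P` and
`α_λ(P,Q)•μ ≤ Q`. -/
theorem alphaPR_mem_PRD {Ω : Type*} [MeasurableSpace Ω] (P Q : Measure Ω)
    [IsProbabilityMeasure P] [IsProbabilityMeasure Q] (l : ℝ≥0) (hl : 0 < l) :
    ((alphaPR P Q l).toReal, (alphaPR P Q l).toReal / (l : ℝ)) ∈ PRD P Q := by
  have hP : (l : ℝ≥0∞) • P ⊓ Q ≤ (l : ℝ≥0∞) • P := inf_le_left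
  have hQ : (l : ℝ≥0∞) • P ⊓ Q ≤ Q := inf_le_right
  have hfin : IsFiniteMeasure ((l : ℝ≥0∞) • P ⊓ Q) := isFiniteMeasure_of_le Q hQ
  obtain ⟨μ, hμ, hμν⟩ := exists_isProbabilityMeasure_smul_eq P ((l : ℝ≥0∞) • P ⊓ Q)
  have hl0 : (l : ℝ≥0∞) ≠ 0 := by exact_mod_cast hl.ne'
  have hα : ENNReal.ofReal (alphaPR P Q l).toReal = alphaPR P Q l :=
    ENNReal.ofReal_toReal (measure_ne_top _ _)
  have hαμ : alphaPR P Q l • μ = (l : ℝ≥0∞) • P ⊓ Q := hμν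
  refine ⟨ENNReal.toReal_nonneg, by positivity, μ, hμ, ?_, ?_⟩
  · rw [ENNReal.ofReal_div_of_pos (by exact_mod_cast hl), hα, ENNReal.ofReal_coe_nnreal,
      div_eq_mul_inv, mul_comm, mul_smul, hαμ]
    calc (l : ℝ≥0∞)⁻¹ • ((l : ℝ≥0∞) • P ⊓ Q) ≤ (l : ℝ≥0∞)⁻¹ • ((l : ℝ≥0∞) • P) := by gcongr
      _ = P := by rw [smul_smul, ENNReal.inv_mul_cancel hl0 ENNReal.coe_ne_top, one_smul]
  · rw [hα, hαμ]
    exact hQ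
end

section
/- If (α,β) ∈ PRD(P,Q) with α > 0 and β > 0, then α ≤ α_{α/β}(P,Q), i.e., α ≤ ((α/β)•P ⊓ Q)(Ω). -/
open MeasureTheory Set
open scoped ENNReal NNReal

/-- If `(α, β) ∈ PRD(P,Q)` with `α > 0` and `β > 0`, then
`α ≤ α_{α/β}(P,Q) = ((α/β)•P ⊓ Q)(Ω)`. -/
theorem PRD_le_alphaPR {Ω : Type*} [MeasurableSpace Ω] (P Q : Measure Ω)
    [IsProbabilityMeasure P] [IsProbabilityMeasure Q]
    (p : ℝ × ℝ) (hp : p ∈ PRD P Q) (hα : 0 < p.1) (hβ : 0 < p.2) :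
    ENNReal.ofReal p.1 ≤ ((ENNReal.ofReal (p.1 / p.2) • P) ⊓ Q) Set.univ := by
  obtain ⟨-, -, μ, hμ, hP, hQ⟩ := hp
  have hscale : ENNReal.ofReal p.1 • μ ≤ ENNReal.ofReal (p.1 / p.2) • P := by
    have hmul : ENNReal.ofReal p.1 = ENNReal.ofReal (p.1 / p.2) * ENNReal.ofReal p.2 := by
      rw [← ENNReal.ofReal_mul (by positivity), div_mul_cancel₀ _ hβ.ne']
    rw [hmul, mul_smul]
    exact Measure.le_iff.2 fun s _ => by
      simpa only [Measure.smul_apply, smul_eq_mul] using mul_le_mul_right (hP s) _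
  simpa using le_inf hscale hQ Set.univ
end

section
/- For every λ ∈ (0,∞) and every p ∈ [0,1], lim_{k→∞} μ_{λ,k}(p) = min(λ·p, 1 − p). -/
open Filter Finset

/-- `Pr[B(k,p) < t]` for a binomial random variable `B(k,p)` with `k` trials and success
probability `p`. -/
noncomputable def binomProbLt (k : ℕ) (p t : ℝ) : ℝ :=
  ∑ i ∈ Finset.range (k + 1),
    if (i : ℝ) < t then (k.choose i : ℝ) * p ^ i * (1 - p) ^ (k - i) else 0

/-- `Pr[B(k,p) > t]` for a binomial random variable `B(k,p)` with `k` trials and success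
probability `p`. -/
noncomputable def binomProbGt (k : ℕ) (p t : ℝ) : ℝ :=
  ∑ i ∈ Finset.range (k + 1),
    if t < (i : ℝ) then (k.choose i : ℝ) * p ^ i * (1 - p) ^ (k - i) else 0

/-- `μ_{λ,k}(p) := λ·p·Pr[B(k,p) < k/(λ+1)] + (1−p)·Pr[B(k,p) > k/(λ+1)]`. -/
noncomputable def muLK (lam : ℝ) (k : ℕ) (p : ℝ) : ℝ :=
  lam * p * binomProbLt k p ((k : ℝ) / (lam + 1)) +
    (1 - p) * binomProbGt k p ((k : ℝ) / (lam + 1))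

/-- The probability that a binomial random variable `B(k,p)` equals `i`. -/
noncomputable def binomWeight (k : ℕ) (p : ℝ) (i : ℕ) : ℝ :=
  (k.choose i : ℝ) * p ^ i * (1 - p) ^ (k - i)

theorem binomWeight_nonneg {p : ℝ} (hp0 : 0 ≤ p) (hp1 : p ≤ 1) (k i : ℕ) :
    0 ≤ binomWeight k p i := by
  have : 0 ≤ 1 - p := by linarith
  unfold binomWeight
  positivity

theorem binomWeight_eq_zero_of_lt {k i : ℕ} (p : ℝ) (h : k < i) : binomWeight k p i = 0 := by
  simp [binomWeight, Nat.choose_eq_zero_of_lt h]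

theorem sum_binomWeight (k : ℕ) (p : ℝ) : ∑ i ∈ range (k + 1), binomWeight k p i = 1 := by
  have h := congrArg (Polynomial.eval p) (bernsteinPolynomial.sum ℝ k)
  simpa [Polynomial.eval_finsetSum, bernsteinPolynomial, binomWeight] using h

theorem sum_sq_mul_binomWeight (k : ℕ) (p : ℝ) :
    ∑ i ∈ range (k + 1), (k * p - i) ^ 2 * binomWeight k p i = k * p * (1 - p) := by
  have h := congrArg (Polynomial.eval p) (bernsteinPolynomial.variance ℝ k)
  simpa [Polynomial.eval_finsetSum, bernsteinPolynomial, binomWeight] using h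

theorem sum_binomWeight_le_one {p : ℝ} (hp0 : 0 ≤ p) (hp1 : p ≤ 1) (k : ℕ) (s : Finset ℕ) :
    ∑ i ∈ s, binomWeight k p i ≤ 1 := by
  calc ∑ i ∈ s, binomWeight k p i ≤ ∑ i ∈ s ∪ range (k + 1), binomWeight k p i :=
        sum_le_sum_of_subset_of_nonneg subset_union_left
          fun i _ _ => binomWeight_nonneg hp0 hp1 k i
    _ = ∑ i ∈ range (k + 1), binomWeight k p i :=
        (sum_subset subset_union_right fun i _ hi =>
          binomWeight_eq_zero_of_lt p (by simpa using hi)).symm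
    _ = 1 := sum_binomWeight k p

theorem binomWeight_le_one {p : ℝ} (hp0 : 0 ≤ p) (hp1 : p ≤ 1) (k i : ℕ) :
    binomWeight k p i ≤ 1 := by
  simpa using sum_binomWeight_le_one hp0 hp1 k {i}

/-- **Chebyshev's inequality** for the binomial distribution. -/
theorem sum_ite_binomWeight_le {p d : ℝ} (hp0 : 0 ≤ p) (hp1 : p ≤ 1) (hd : 0 < d) {k : ℕ}
    (hk : 0 < k) (A : ℕ → Prop) [DecidablePred A] (hA : ∀ i, A i → k * d ≤ |k * p - i|) :
    ∑ i ∈ range (k + 1), (if A i then binomWeight k p i else 0) ≤ p * (1 - p) / d ^ 2 / k := by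
  have hk' : (0 : ℝ) < k := by exact_mod_cast hk
  have key : ∑ i ∈ range (k + 1), (k * d) ^ 2 * (if A i then binomWeight k p i else 0) ≤
      k * p * (1 - p) := by
    rw [← sum_sq_mul_binomWeight]
    refine sum_le_sum fun i _ => ?_
    have hw := binomWeight_nonneg hp0 hp1 k i
    split_ifs with h
    · refine mul_le_mul_of_nonneg_right ?_ hw
      rw [← sq_abs (k * p - i)]
      exact pow_le_pow_left₀ (by positivity) (hA i h) 2
    · simp only [mul_zero]
      positivity
  rw [← mul_sum] at key
  rw [div_div, le_div_iff₀ (by positivity)]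
  refine le_of_mul_le_mul_left ?_ hk'
  linarith

theorem tendsto_sum_ite_binomWeight_zero {p d : ℝ} (hp0 : 0 ≤ p) (hp1 : p ≤ 1) (hd : 0 < d)
    (A : ℕ → ℕ → Prop) [∀ k, DecidablePred (A k)] (hA : ∀ k i, A k i → k * d ≤ |k * p - i|) :
    Tendsto (fun k : ℕ => ∑ i ∈ range (k + 1), (if A k i then binomWeight k p i else 0))
      atTop (nhds 0) := by
  refine squeeze_zero' (.of_forall fun k => sum_nonneg fun i _ => ?_) ?_
    (tendsto_const_div_atTop_nhds_zero_nat (p * (1 - p) / d ^ 2))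
  · split_ifs
    · exact binomWeight_nonneg hp0 hp1 k i
    · exact le_rfl
  · filter_upwards [eventually_gt_atTop 0] with k hk
    exact sum_ite_binomWeight_le hp0 hp1 hd hk (A k) (hA k)

theorem binomWeight_succ_mul (k i : ℕ) (p : ℝ) :
    binomWeight k p (i + 1) * ((i + 1) * (1 - p)) = binomWeight k p i * ((k - i) * p) := by
  rcases lt_or_ge i k with h | h
  · obtain ⟨m, rfl⟩ : ∃ m, k = i + 1 + m := Nat.exists_eq_add_of_le h
    have hc : (((i + 1 + m).choose (i + 1) : ℕ) : ℝ) * (i + 1) =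
        (i + 1 + m).choose i * (m + 1) := by
      have := Nat.choose_succ_right_eq (i + 1 + m) i
      rw [show i + 1 + m - i = m + 1 by omega] at this
      exact_mod_cast this
    simp only [binomWeight]
    rw [show i + 1 + m - (i + 1) = m by omega, show i + 1 + m - i = m + 1 by omega]
    push_cast
    linear_combination p ^ (i + 1) * (1 - p) ^ (m + 1) * hc
  · rw [binomWeight_eq_zero_of_lt p (by omega : k < i + 1)]
    rcases h.eq_or_lt with rfl | h
    · simp
    · simp [binomWeight_eq_zero_of_lt p h]

/-- Just above the mean, the binomial weights decrease slowly. -/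
theorem binomWeight_sub_le_binomWeight_add {p : ℝ} (hp0 : 0 < p) (hp1 : p < 1) {k j : ℕ}
    (hk : 0 < k) (hj : (j : ℝ) = k * p) (i : ℕ) :
    binomWeight k p j - i ^ 2 / (k * (p * (1 - p))) ≤ binomWeight k p (j + i) := by
  have hk' : (0 : ℝ) < k := by exact_mod_cast hk
  have hq : 0 < 1 - p := by linarith
  induction i with
  | zero => simp
  | succ i ih =>
    have hrec := binomWeight_succ_mul k (j + i) p
    have hw0 := binomWeight_nonneg hp0.le hp1.le k (j + i)
    have hw1 := binomWeight_le_one hp0.le hp1.le k (j + i)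
    rw [← add_assoc]
    push_cast at hrec ⊢
    rw [hj] at hrec
    have hi : (0 : ℝ) ≤ i := i.cast_nonneg
    set w := binomWeight k p (j + i)
    set w' := binomWeight k p (j + i + 1)
    have hD : 0 < (k * p + i + 1) * (1 - p) := by positivity
    have hstep : w - (i + 1) / (k * (p * (1 - p))) ≤ w' := by
      have hdiff : w - w' = w * (i * p + (i + 1) * (1 - p)) / ((k * p + i + 1) * (1 - p)) := by
        rw [eq_div_iff hD.ne']
        linear_combination -hrec
      have hle : w * (i * p + (i + 1) * (1 - p)) / ((k * p + i + 1) * (1 - p)) ≤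
          (i + 1) / (k * (p * (1 - p))) := by
        apply div_le_div₀ (by positivity)
        · nlinarith [mul_nonneg hi hp0.le, mul_nonneg hi hq.le]
        · positivity
        · nlinarith
      linarith
    have hsq : (i : ℝ) ^ 2 / (k * (p * (1 - p))) + (i + 1) / (k * (p * (1 - p))) ≤
        (i + 1) ^ 2 / (k * (p * (1 - p))) := by
      rw [← add_div]
      gcongr
      nlinarith
    linarith

theorem binomWeight_mean_le {p : ℝ} (hp0 : 0 < p) (hp1 : p < 1) {k j M : ℕ}
    (hk : 0 < k) (hM : 0 < M) (hj : (j : ℝ) = k * p) :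
    binomWeight k p j ≤ 1 / M + M ^ 2 / (p * (1 - p)) / k := by
  have hq : 0 < 1 - p := by linarith
  have hM' : (0 : ℝ) < M := by exact_mod_cast hM
  have hsum : ∑ i ∈ range M, binomWeight k p (j + i) ≤ 1 := by
    have := sum_binomWeight_le_one hp0.le hp1.le k ((range M).map (addLeftEmbedding j))
    simpa using this
  have hlow : ∑ i ∈ range M, (binomWeight k p j - M ^ 2 / (k * (p * (1 - p)))) ≤
      ∑ i ∈ range M, binomWeight k p (j + i) := by
    refine sum_le_sum fun i hi => ?_
    refine le_trans ?_ (binomWeight_sub_le_binomWeight_add hp0 hp1 hk hj i)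
    have : (i : ℝ) ≤ M := by exact_mod_cast (mem_range.1 hi).le
    gcongr
  rw [sum_const, card_range, nsmul_eq_mul] at hlow
  have : binomWeight k p j - M ^ 2 / (k * (p * (1 - p))) ≤ 1 / M := by
    rw [le_div_iff₀' hM']
    linarith
  rw [div_div, mul_comm (p * (1 - p))]
  linarith

/-- The probability that a binomial random variable equals its mean tends to zero. -/
theorem tendsto_sum_ite_eq_mean_binomWeight {p : ℝ} (hp0 : 0 < p) (hp1 : p < 1) :
    Tendsto (fun k : ℕ => ∑ i ∈ range (k + 1),
      (if (i : ℝ) = k * p then binomWeight k p i else 0)) atTop (nhds 0) := by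
  have hnonneg (k : ℕ) : 0 ≤ ∑ i ∈ range (k + 1),
      (if (i : ℝ) = k * p then binomWeight k p i else 0) := by
    refine sum_nonneg fun i _ => ?_
    split_ifs
    · exact binomWeight_nonneg hp0.le hp1.le k i
    · exact le_rfl
  have hq : 0 < 1 - p := by linarith
  rw [Metric.tendsto_atTop']
  intro ε hε
  obtain ⟨n, hn⟩ := exists_nat_one_div_lt (half_pos hε)
  obtain ⟨N, hN⟩ := eventually_atTop.1 ((tendsto_const_div_atTop_nhds_zero_nat
    (((n + 1 : ℕ) : ℝ) ^ 2 / (p * (1 - p)))).eventually_lt_const (half_pos hε))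
  refine ⟨N, fun k hk => ?_⟩
  rw [Real.dist_eq, sub_zero, abs_of_nonneg (hnonneg k)]
  by_cases h : ∃ j : ℕ, (j : ℝ) = k * p
  · obtain ⟨j, hj⟩ := h
    have hle := binomWeight_mean_le hp0 hp1 (by omega : 0 < k) n.succ_pos hj
    have hNk := hN k hk.le
    have hlt : binomWeight k p j < ε := by
      push_cast at hle hNk
      linarith
    simp only [← hj, Nat.cast_inj, sum_ite_eq']
    split_ifs
    · exact hlt
    · exact hε
  · push Not at h
    simpa [h] using hε

theorem binomProbLt_add_sum_ite_add_binomProbGt (k : ℕ) (p t : ℝ) :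
    binomProbLt k p t + (∑ i ∈ range (k + 1), (if (i : ℝ) = t then binomWeight k p i else 0)) +
      binomProbGt k p t = 1 := by
  rw [← sum_binomWeight k p, binomProbLt, binomProbGt, ← sum_add_distrib, ← sum_add_distrib]
  refine sum_congr rfl fun i _ => ?_
  rcases lt_trichotomy (i : ℝ) t with h | h | h
  · simp [h, h.ne, h.not_gt, binomWeight]
  · simp [h]
  · simp [h, h.ne', h.not_gt, binomWeight]

theorem tendsto_binomProbGt_zero {p q : ℝ} (hp0 : 0 ≤ p) (hp1 : p ≤ 1) (hpq : p < q) :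
    Tendsto (fun k : ℕ => binomProbGt k p (k * q)) atTop (nhds 0) := by
  refine tendsto_sum_ite_binomWeight_zero hp0 hp1 (sub_pos.2 hpq) (fun k i => k * q < (i : ℝ)) ?_
  intro k i h
  rw [abs_sub_comm]
  exact le_trans (by linarith) (le_abs_self _)

theorem tendsto_binomProbLt_zero {p q : ℝ} (hp0 : 0 ≤ p) (hp1 : p ≤ 1) (hqp : q < p) :
    Tendsto (fun k : ℕ => binomProbLt k p (k * q)) atTop (nhds 0) := by
  refine tendsto_sum_ite_binomWeight_zero hp0 hp1 (sub_pos.2 hqp) (fun k i => (i : ℝ) < k * q) ?_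
  intro k i h
  exact le_trans (by linarith) (le_abs_self _)

theorem tendsto_sum_ite_eq_binomWeight {p q : ℝ} (hp0 : 0 ≤ p) (hp1 : p ≤ 1) (hpq : p ≠ q) :
    Tendsto (fun k : ℕ => ∑ i ∈ range (k + 1),
      (if (i : ℝ) = k * q then binomWeight k p i else 0)) atTop (nhds 0) := by
  refine tendsto_sum_ite_binomWeight_zero hp0 hp1 (abs_pos.2 (sub_ne_zero.2 hpq))
    (fun k i => (i : ℝ) = k * q) ?_
  intro k i h
  rw [h, ← mul_sub, abs_mul, Nat.abs_cast]

/-- For every `λ ∈ (0,∞)` and every `p ∈ [0,1]`,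
`lim_{k→∞} μ_{λ,k}(p) = min(λ·p, 1 − p)`. -/
theorem muLK_tendsto_min (lam : ℝ) (hlam : 0 < lam) (p : ℝ) (hp0 : 0 ≤ p) (hp1 : p ≤ 1) :
    Tendsto (fun k : ℕ => muLK lam k p) atTop (nhds (min (lam * p) (1 - p))) := by
  have hl : 0 < lam + 1 := by linarith
  obtain ⟨q, hq⟩ : ∃ q, q = (lam + 1)⁻¹ := ⟨_, rfl⟩
  have hql : q * (lam + 1) = 1 := by rw [hq, inv_mul_cancel₀ hl.ne']
  simp only [muLK, div_eq_mul_inv, ← hq]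
  have htotal (k : ℕ) := binomProbLt_add_sum_ite_add_binomProbGt k p (k * q)
  rcases lt_trichotomy p q with h | rfl | h
  · have hmin : lam * p ≤ 1 - p := by nlinarith
    rw [min_eq_left hmin]
    have hG := tendsto_binomProbGt_zero hp0 hp1 h
    have hE := tendsto_sum_ite_eq_binomWeight hp0 hp1 h.ne
    have hlim := (((hE.add hG).const_sub 1).const_mul (lam * p)).add (hG.const_mul (1 - p))
    simp only [add_zero, sub_zero, mul_one, mul_zero] at hlim
    refine hlim.congr fun k => ?_
    linear_combination (-(lam * p)) * htotal k
  · have hp : 0 < p := by rw [hq]; positivity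
    have heq : lam * p = 1 - p := by linarith
    have hE := tendsto_sum_ite_eq_mean_binomWeight hp (by nlinarith)
    rw [heq, min_self]
    have hlim := (hE.const_sub 1).const_mul (1 - p)
    simp only [sub_zero, mul_one] at hlim
    refine hlim.congr fun k => ?_
    linear_combination (-(1 - p)) * htotal k
  · have hmin : 1 - p ≤ lam * p := by nlinarith
    rw [min_eq_right hmin]
    have hL := tendsto_binomProbLt_zero hp0 hp1 h
    have hE := tendsto_sum_ite_eq_binomWeight hp0 hp1 h.ne'
    have hlim := (hL.const_mul (lam * p)).add (((hL.add hE).const_sub 1).const_mul (1 - p))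
    simp only [add_zero, zero_add, sub_zero, mul_one, mul_zero] at hlim
    refine hlim.congr fun k => ?_
    linear_combination (-(1 - p)) * htotal k
end

section
/- For every b ∈ (0,∞), define F_b(P,Q) := sup_{λ ∈ (0,∞)} (1 + b²)·α_λ(P,Q)/(b² + λ). Then lim_{b→∞} F_b(P,Q) = α_∞(P,Q). -/
open MeasureTheory Filter Set
open scoped ENNReal NNReal

/-- The F-score `F_b(P,Q) := sup_{λ ∈ (0,∞)} (1 + b²)·α_λ(P,Q)/(b² + λ)`. -/
noncomputable def Fscore {Ω : Type*} [MeasurableSpace Ω] (P Q : Measure Ω) (b : ℝ≥0) : ℝ≥0∞ :=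
  ⨆ (l : ℝ≥0) (_ : 0 < l), (1 + (b : ℝ≥0∞) ^ 2) * alphaPR P Q l / ((b : ℝ≥0∞) ^ 2 + l)

/-- `λ ↦ α_λ(P,Q)` is nondecreasing. -/
theorem alphaPR_mono {Ω : Type*} [MeasurableSpace Ω] (P Q : Measure Ω) :
    Monotone (alphaPR P Q) := by
  intro l m hlm
  have h : (l : ℝ≥0∞) • P ≤ (m : ℝ≥0∞) • P := by
    refine Measure.le_iff.2 fun s _ => ?_
    simp only [Measure.smul_apply, smul_eq_mul]
    gcongr
  exact inf_le_inf_right Q h Set.univ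

/-- The weight `(1 + b²)/(b² + λ)` tends to `1` as `b → ∞`. -/
theorem tendsto_one_add_sq_div_sq_add (l : ℝ≥0) :
    Tendsto (fun b : ℝ≥0 => (1 + (b : ℝ≥0∞) ^ 2) / ((b : ℝ≥0∞) ^ 2 + l)) atTop (nhds 1) := by
  have hsq : Tendsto (fun b : ℝ≥0 => (b : ℝ) ^ 2 + l) atTop atTop :=
    tendsto_atTop_add_const_right _ _
      ((tendsto_pow_atTop two_ne_zero).comp (NNReal.tendsto_coe_atTop.2 tendsto_id))
  have hreal : Tendsto (fun b : ℝ≥0 => 1 + (1 - (l : ℝ)) / ((b : ℝ) ^ 2 + l)) atTop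
      (nhds 1) := by
    simpa using (hsq.const_div_atTop (1 - (l : ℝ))).const_add 1
  have hnn : Tendsto (fun b : ℝ≥0 => (1 + b ^ 2) / (b ^ 2 + l)) atTop (nhds 1) := by
    rw [← NNReal.tendsto_coe]
    refine hreal.congr' ?_
    filter_upwards [eventually_gt_atTop 0] with b hb
    have hb' : (0 : ℝ) < b := hb
    have hpos : (0 : ℝ) < (b : ℝ) ^ 2 + l := by positivity
    push_cast
    field_simp
    ring
  refine (ENNReal.tendsto_coe.2 hnn).congr' ?_
  filter_upwards [eventually_gt_atTop 0] with b hb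
  have hne : b ^ 2 + l ≠ 0 := by positivity
  rw [ENNReal.coe_div hne]
  push_cast
  rfl

/-- `lim_{b→∞} F_b(P,Q) = α_∞(P,Q)`, where `α_∞(P,Q)` is the limit of `α_λ(P,Q)` as
`λ → ∞`. -/
theorem Fscore_tendsto_alphaInf {Ω : Type*} [MeasurableSpace Ω]
    (P Q : Measure Ω) [IsProbabilityMeasure P] [IsProbabilityMeasure Q]
    (alphaInf : ℝ≥0∞) (hlim : Tendsto (alphaPR P Q) atTop (nhds alphaInf)) :
    Tendsto (Fscore P Q) atTop (nhds alphaInf) := by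
  have hle (l : ℝ≥0) : alphaPR P Q l ≤ alphaInf := (alphaPR_mono P Q).ge_of_tendsto hlim l
  have hweight (l : ℝ≥0) (a : ℝ≥0∞) :
      Tendsto (fun b : ℝ≥0 => (1 + (b : ℝ≥0∞) ^ 2) * a / ((b : ℝ≥0∞) ^ 2 + l)) atTop
        (nhds a) := by
    simpa [ENNReal.mul_div_right_comm] using
      ENNReal.Tendsto.mul_const (b := a) (tendsto_one_add_sq_div_sq_add l) (Or.inl one_ne_zero)
  refine tendsto_order.2 ⟨fun a ha => ?_, fun a ha => ?_⟩
  · obtain ⟨l, hal, hl⟩ := ((hlim.eventually_const_lt ha).and (eventually_gt_atTop 0)).exists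
    filter_upwards [(hweight l _).eventually_const_lt hal] with b hb
    exact hb.trans_le (le_iSup₂_of_le l hl le_rfl)
  · filter_upwards [(hweight 0 alphaInf).eventually_lt_const ha] with b hb
    refine lt_of_le_of_lt (iSup₂_le fun l _ => ?_) hb
    gcongr
    · exact hle l
end
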